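/- Let A_1(N), …, A_k(N) be a unitarily invariant ensemble. Then for every r ≥ 1, all noncommutative polynomials q_1, …, q_r in k variables, and all fixed indices j_1, …, j_r, i_1, …, i_r (independent of N), lim_{N→∞} ( E ∏_{s=1}^r [q_s(A_1(N), …, A_k(N))]_{j_s, i_s} − ∏_{s=1}^r E [q_s(A_1(N), …, A_k(N))]_{j_s, i_s} ) = 0; i.e., the matrix entries of polynomials in the ensemble asymptotically factorize in expectation. -/

import Mathlib

open Matrix MeasureTheory Filter

noncomputable instance {N : ℕ} : MeasurableSpace (Matrix.unitaryGroup (Fin N) ℂ) :=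
  borel _

/-- The ℓ²→ℓ² operator norm of a complex matrix. -/
noncomputable def opNorm {N : ℕ} (X : Matrix (Fin N) (Fin N) ℂ) : ℝ :=
  ‖Matrix.toEuclideanCLM (𝕜 := ℂ) X‖

/-- Evaluation of a noncommutative polynomial `q` at the matrices `UΛ₁U*, …, UΛ_kU*`. -/
noncomputable def evalAt {k N : ℕ} (Λ : Fin k → Matrix (Fin N) (Fin N) ℂ)
    (U : Matrix.unitaryGroup (Fin N) ℂ) (q : FreeAlgebra ℂ (Fin k)) :
    Matrix (Fin N) (Fin N) ℂ :=
  FreeAlgebra.lift ℂ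
    (fun j => (U : Matrix (Fin N) (Fin N) ℂ) * Λ j * (U : Matrix (Fin N) (Fin N) ℂ)ᴴ) q

/-- The `(a,b)` entry of an `N×N` matrix for fixed natural-number indices `a, b`
(defined to be `0` if `a ≥ N` or `b ≥ N`). -/
def entryPad {N : ℕ} (M : Matrix (Fin N) (Fin N) ℂ) (a b : ℕ) : ℂ :=
  if ha : a < N then (if hb : b < N then M ⟨a, ha⟩ ⟨b, hb⟩ else 0) else 0

instance instBorelU {N : ℕ} : BorelSpace (Matrix.unitaryGroup (Fin N) ℂ) := ⟨rfl⟩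

lemma opNorm_mul_le' {N : ℕ} (X Y : Matrix (Fin N) (Fin N) ℂ) :
    opNorm (X * Y) ≤ opNorm X * opNorm Y := by
  unfold opNorm
  rw [map_mul]
  exact norm_mul_le _ _

lemma opNorm_unitary_le {N : ℕ} (U : Matrix.unitaryGroup (Fin N) ℂ) :
    opNorm (U : Matrix (Fin N) (Fin N) ℂ) ≤ 1 := by
  unfold opNorm
  have h : Matrix.toEuclideanCLM (𝕜 := ℂ) (U : Matrix (Fin N) (Fin N) ℂ) ∈
      unitary (EuclideanSpace ℂ (Fin N) →L[ℂ] EuclideanSpace ℂ (Fin N)) :=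
    Unitary.map_mem (Matrix.toEuclideanCLM (𝕜 := ℂ) (n := Fin N)) U.2
  rw [← mul_one (Matrix.toEuclideanCLM (𝕜 := ℂ) (U : Matrix (Fin N) (Fin N) ℂ)),
    CStarRing.norm_mem_unitary_mul _ h]
  exact ContinuousLinearMap.norm_id_le

lemma opNorm_conj_le {N : ℕ} (U : Matrix.unitaryGroup (Fin N) ℂ)
    (X : Matrix (Fin N) (Fin N) ℂ) :
    opNorm ((U : Matrix (Fin N) (Fin N) ℂ) * X * (U : Matrix (Fin N) (Fin N) ℂ)ᴴ) ≤ opNorm X := by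
  have h1 := opNorm_unitary_le U
  have h2 := opNorm_unitary_le (star U)
  have h3 : ((star U : Matrix.unitaryGroup (Fin N) ℂ) : Matrix (Fin N) (Fin N) ℂ)
    = (U : Matrix (Fin N) (Fin N) ℂ)ᴴ := rfl
  rw [h3] at h2
  have h0 : ∀ Z : Matrix (Fin N) (Fin N) ℂ, 0 ≤ opNorm Z := fun Z => norm_nonneg _
  calc _ ≤ opNorm ((U : Matrix (Fin N) (Fin N) ℂ) * X) * opNorm (U : Matrix (Fin N) (Fin N) ℂ)ᴴ :=
        opNorm_mul_le' _ _
    _ ≤ (opNorm (U : Matrix (Fin N) (Fin N) ℂ) * opNorm X) * 1 := by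
        gcongr
        · exact h0 _
        · exact mul_nonneg (h0 _) (h0 _)
        · exact opNorm_mul_le' _ _
    _ ≤ (1 * opNorm X) * 1 := by gcongr; exact h0 _
    _ = _ := by ring

lemma col_bound {N : ℕ} (X : Matrix (Fin N) (Fin N) ℂ) (b : Fin N) :
    ∑ a, ‖X a b‖ ^ 2 ≤ opNorm X ^ 2 := by
  have h := (Matrix.toEuclideanCLM (𝕜 := ℂ) X).le_opNorm (EuclideanSpace.single b 1)
  rw [EuclideanSpace.norm_single, norm_one, mul_one] at h
  have h2 := pow_le_pow_left₀ (norm_nonneg _) h 2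
  rw [EuclideanSpace.norm_sq_eq] at h2
  refine le_trans (le_of_eq ?_) h2
  refine Finset.sum_congr rfl fun a _ => ?_
  rw [Matrix.ofLp_toEuclideanCLM]
  simp

lemma entry_bound {N : ℕ} (X : Matrix (Fin N) (Fin N) ℂ) (a b : Fin N) :
    ‖X a b‖ ≤ opNorm X := by
  have h := col_bound X b
  have h1 : ‖X a b‖ ^ 2 ≤ ∑ a, ‖X a b‖ ^ 2 :=
    Finset.single_le_sum (f := fun a => ‖X a b‖ ^ 2) (fun _ _ => sq_nonneg _) (Finset.mem_univ a)
  exact le_of_sq_le_sq (h1.trans h) (norm_nonneg _)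

lemma evalAt_conj {k N : ℕ} (Λ : Fin k → Matrix (Fin N) (Fin N) ℂ)
    (U : Matrix.unitaryGroup (Fin N) ℂ) (q : FreeAlgebra ℂ (Fin k)) :
    evalAt Λ U q = (U : Matrix (Fin N) (Fin N) ℂ) * FreeAlgebra.lift ℂ Λ q *
      (U : Matrix (Fin N) (Fin N) ℂ)ᴴ := by
  have hU : (U : Matrix (Fin N) (Fin N) ℂ) * (U : Matrix (Fin N) (Fin N) ℂ)ᴴ = 1 :=
    Unitary.mul_star_self_of_mem U.2
  have hU' : (U : Matrix (Fin N) (Fin N) ℂ)ᴴ * (U : Matrix (Fin N) (Fin N) ℂ) = 1 :=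
    Unitary.star_mul_self_of_mem U.2
  unfold evalAt
  induction q using FreeAlgebra.induction with
  | grade0 r =>
    rw [AlgHom.commutes, AlgHom.commutes, Algebra.algebraMap_eq_smul_one]
    simp [hU]
  | grade1 x => simp
  | mul x y hx hy =>
    rw [map_mul, map_mul, hx, hy]
    generalize FreeAlgebra.lift ℂ Λ x = A
    generalize FreeAlgebra.lift ℂ Λ y = B
    calc _ = (U : Matrix (Fin N) (Fin N) ℂ) * A * ((U : Matrix (Fin N) (Fin N) ℂ)ᴴ *
          (U : Matrix (Fin N) (Fin N) ℂ)) * B * (U : Matrix (Fin N) (Fin N) ℂ)ᴴ := by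
          simp only [mul_assoc]
      _ = _ := by rw [hU']; simp only [mul_assoc, one_mul]
  | add x y hx hy => rw [map_add, map_add, hx, hy, mul_add, add_mul]

lemma opNorm_lift_bound {k : ℕ} (Λ : (N : ℕ) → Fin k → Matrix (Fin N) (Fin N) ℂ)
    (hΛbdd : ∃ C : ℝ, ∀ N t, opNorm (Λ N t) ≤ C) (q : FreeAlgebra ℂ (Fin k)) :
    ∃ K : ℝ, ∀ N, opNorm (FreeAlgebra.lift ℂ (Λ N) q) ≤ K := by
  induction q using FreeAlgebra.induction with
  | grade0 r =>
    refine ⟨‖r‖ * 1, fun N => ?_⟩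
    rw [AlgHom.commutes, Algebra.algebraMap_eq_smul_one]
    have h := opNorm_unitary_le (1 : Matrix.unitaryGroup (Fin N) ℂ)
    unfold opNorm at *
    rw [map_smul, norm_smul]
    gcongr
    exact h
  | grade1 x =>
    obtain ⟨C, hC⟩ := hΛbdd
    exact ⟨C, fun N => by simpa using hC N x⟩
  | mul x y hx hy =>
    obtain ⟨A, hA⟩ := hx
    obtain ⟨B, hB⟩ := hy
    refine ⟨A * B, fun N => ?_⟩
    rw [map_mul]
    refine (opNorm_mul_le' _ _).trans ?_
    have h0 : ∀ Z : Matrix (Fin N) (Fin N) ℂ, 0 ≤ opNorm Z := fun Z => norm_nonneg _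
    exact mul_le_mul (hA N) (hB N) (h0 _) ((h0 _).trans (hA N))
  | add x y hx hy =>
    obtain ⟨A, hA⟩ := hx
    obtain ⟨B, hB⟩ := hy
    refine ⟨A + B, fun N => ?_⟩
    rw [map_add]
    refine le_trans ?_ (add_le_add (hA N) (hB N))
    unfold opNorm
    rw [map_add]
    exact norm_add_le _ _

/-- conjugate of M by U -/
noncomputable def cj {N : ℕ} (M : Matrix (Fin N) (Fin N) ℂ)
    (U : Matrix.unitaryGroup (Fin N) ℂ) : Matrix (Fin N) (Fin N) ℂ :=
  (U : Matrix (Fin N) (Fin N) ℂ) * M * (U : Matrix (Fin N) (Fin N) ℂ)ᴴ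

lemma cj_cont {N : ℕ} (M : Matrix (Fin N) (Fin N) ℂ) (a b : Fin N) :
    Continuous (fun U => cj M U a b) := by
  have h : Continuous (fun U => cj M U) := by
    unfold cj
    have : Continuous (fun U : Matrix.unitaryGroup (Fin N) ℂ => (U : Matrix (Fin N) (Fin N) ℂ)) :=
      continuous_subtype_val
    fun_prop
  exact h.matrix_elem a b

lemma cj_mul {N : ℕ} (M : Matrix (Fin N) (Fin N) ℂ) (V U : Matrix.unitaryGroup (Fin N) ℂ) :
    cj M (V * U) = (V : Matrix (Fin N) (Fin N) ℂ) * cj M U * (V : Matrix (Fin N) (Fin N) ℂ)ᴴ := by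
  unfold cj
  rw [Matrix.UnitaryGroup.mul_val, Matrix.conjTranspose_mul]
  simp only [mul_assoc]

lemma bdd_integrable {N : ℕ} (μ : Measure (Matrix.unitaryGroup (Fin N) ℂ)) [IsProbabilityMeasure μ]
    {E : Type*} [NormedAddCommGroup E] [SecondCountableTopology E]
    (f : Matrix.unitaryGroup (Fin N) ℂ → E) (hf : Continuous f) (C : ℝ) (hC : ∀ U, ‖f U‖ ≤ C) :
    Integrable f μ :=
  Integrable.of_bound (hf.aestronglyMeasurable) C (Eventually.of_forall hC)

/-- swap matrix -/
def sw {N : ℕ} (a b : Fin N) : Matrix (Fin N) (Fin N) ℂ :=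
  (1 : Matrix (Fin N) (Fin N) ℂ).submatrix (Equiv.swap a b) id

lemma sw_mul {N : ℕ} (a b : Fin N) (X : Matrix (Fin N) (Fin N) ℂ) (x y : Fin N) :
    (sw a b * X) x y = X (Equiv.swap a b x) y := by
  simp [sw, Matrix.mul_apply, Matrix.one_apply]

lemma sw_conjTranspose {N : ℕ} (a b : Fin N) : (sw a b)ᴴ = sw a b := by
  ext x y
  simp only [sw, Matrix.conjTranspose_apply, Matrix.submatrix_apply, Matrix.one_apply, id]
  by_cases h : Equiv.swap a b y = x
  · have : Equiv.swap a b x = y := by rw [← h]; simp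
    simp [h, this]
  · have : ¬ Equiv.swap a b x = y := by rintro rfl; simp at h
    simp [h, this]

lemma mul_sw {N : ℕ} (a b : Fin N) (X : Matrix (Fin N) (Fin N) ℂ) (x y : Fin N) :
    (X * sw a b) x y = X x (Equiv.swap a b y) := by
  have h := sw_mul a b Xᴴ y x
  rw [← sw_conjTranspose, ← Matrix.conjTranspose_mul] at h
  simpa using congrArg star h

lemma sw_sq {N : ℕ} (a b : Fin N) : sw a b * sw a b = 1 := by
  ext x y
  rw [sw_mul]
  simp only [sw, Matrix.submatrix_apply, Equiv.swap_apply_self, Equiv.symm_apply_apply, id]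
  rw [← Equiv.Perm.mul_apply, Equiv.swap_mul_self, Equiv.Perm.one_apply]
  rfl

def swU {N : ℕ} (a b : Fin N) : Matrix.unitaryGroup (Fin N) ℂ :=
  ⟨sw a b, by
    rw [Matrix.mem_unitaryGroup_iff, Matrix.star_eq_conjTranspose, sw_conjTranspose, sw_sq]⟩

/-- square root of the swap matrix -/
noncomputable def rt {N : ℕ} (a b : Fin N) : Matrix (Fin N) (Fin N) ℂ :=
  ((1 + Complex.I) / 2) • (1 : Matrix (Fin N) (Fin N) ℂ) + ((1 - Complex.I) / 2) • sw a b

lemma rt_star {N : ℕ} (a b : Fin N) : (rt a b)ᴴ =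
    ((1 - Complex.I) / 2) • (1 : Matrix (Fin N) (Fin N) ℂ) + ((1 + Complex.I) / 2) • sw a b := by
  unfold rt
  rw [Matrix.conjTranspose_add, Matrix.conjTranspose_smul, Matrix.conjTranspose_smul,
    sw_conjTranspose, Matrix.conjTranspose_one]
  congr 2 <;> simp [sub_eq_add_neg]

lemma rt_conj {N : ℕ} (a b : Fin N) (X : Matrix (Fin N) (Fin N) ℂ) :
    rt a b * X * (rt a b)ᴴ = (1 / 2 : ℂ) • X + (Complex.I / 2) • (X * sw a b)
      - (Complex.I / 2) • (sw a b * X) + (1 / 2 : ℂ) • (sw a b * X * sw a b) := by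
  rw [rt_star]
  unfold rt
  simp only [add_mul, mul_add, Matrix.smul_mul, Matrix.mul_smul, one_mul, mul_one]
  simp only [smul_smul]
  have h1 : (1 - Complex.I) / 2 * ((1 + Complex.I) / 2) = 1 / 2 := by
    ring_nf; rw [Complex.I_sq]; norm_num
  have h2 : (1 + Complex.I) / 2 * ((1 + Complex.I) / 2) = Complex.I / 2 := by
    ring_nf; rw [Complex.I_sq]; ring
  have h3 : (1 - Complex.I) / 2 * ((1 - Complex.I) / 2) = - (Complex.I / 2) := by
    ring_nf; rw [Complex.I_sq]; ring
  have h4 : (1 + Complex.I) / 2 * ((1 - Complex.I) / 2) = 1 / 2 := by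
    rw [mul_comm]; exact h1
  simp only [h1, h2, h3, h4, neg_smul]
  abel

noncomputable def rtU {N : ℕ} (a b : Fin N) : Matrix.unitaryGroup (Fin N) ℂ :=
  ⟨rt a b, by
    rw [Matrix.mem_unitaryGroup_iff, Matrix.star_eq_conjTranspose]
    have h := rt_conj a b 1
    rw [mul_one] at h
    rw [h]
    simp only [one_mul, mul_one, sw_sq]
    rw [add_sub_cancel_right, ← add_smul]
    norm_num⟩

section main
variable {N : ℕ} (μ : Measure (Matrix.unitaryGroup (Fin N) ℂ)) [IsProbabilityMeasure μ]
  [μ.IsMulLeftInvariant] (M : Matrix (Fin N) (Fin N) ℂ) (K : ℝ) (hK : opNorm M ≤ K)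

lemma cj_bound (M : Matrix (Fin N) (Fin N) ℂ) (K : ℝ) (hK : opNorm M ≤ K)
    (U : Matrix.unitaryGroup (Fin N) ℂ) (a b : Fin N) : ‖cj M U a b‖ ≤ K :=
  (entry_bound _ a b).trans ((opNorm_conj_le U M).trans hK)

lemma int_sq (μ : Measure (Matrix.unitaryGroup (Fin N) ℂ)) [IsProbabilityMeasure μ]
    (M : Matrix (Fin N) (Fin N) ℂ) (a b : Fin N) :
    Integrable (fun U => ‖cj M U a b‖ ^ 2) μ := by
  refine bdd_integrable μ _ ((cj_cont M a b).norm.pow 2) (opNorm M ^ 2) fun U => ?_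
  rw [norm_pow, norm_norm]
  exact pow_le_pow_left₀ (norm_nonneg _) (cj_bound M _ le_rfl U a b) 2

include hK in
lemma offdiag (a b : Fin N) (hab : a ≠ b) :
    ∫ U, ‖cj M U a b‖ ^ 2 ∂μ ≤ K ^ 2 / ((N : ℝ) - 1) := by
  have heq : ∀ c, c ≠ b → ∫ U, ‖cj M U c b‖ ^ 2 ∂μ = ∫ U, ‖cj M U a b‖ ^ 2 ∂μ := by
    intro c hc
    rw [← integral_mul_left_eq_self (fun U => ‖cj M U a b‖ ^ 2) (swU a c)]
    refine integral_congr_ae (Eventually.of_forall fun U => ?_)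
    simp only
    rw [cj_mul]
    change _ = ‖(sw a c * cj M U * (sw a c)ᴴ) a b‖ ^ 2
    rw [sw_conjTranspose, mul_sw, sw_mul, Equiv.swap_apply_left,
      Equiv.swap_apply_of_ne_of_ne hab.symm hc.symm]
  have hN : 1 < N := by
    have := a.2; have := b.2
    have : (a : ℕ) ≠ b := fun h => hab (Fin.ext h)
    omega
  have hN' : (0 : ℝ) < (N : ℝ) - 1 := by
    have : (1 : ℝ) < N := by exact_mod_cast hN
    linarith
  rw [le_div_iff₀ hN']
  have h1 : ∑ c ∈ Finset.univ.erase b, ∫ U, ‖cj M U c b‖ ^ 2 ∂μ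
      = ((N : ℝ) - 1) * ∫ U, ‖cj M U a b‖ ^ 2 ∂μ := by
    rw [Finset.sum_congr rfl (fun c hc => heq c (Finset.ne_of_mem_erase hc)), Finset.sum_const,
      Finset.card_erase_of_mem (Finset.mem_univ _), Finset.card_univ, Fintype.card_fin,
      nsmul_eq_mul, Nat.cast_sub hN.le, Nat.cast_one]
  rw [mul_comm, ← h1, ← integral_finsetSum _ (fun c _ => int_sq μ M c b)]
  have h2 : ∀ U, ∑ c ∈ Finset.univ.erase b, ‖cj M U c b‖ ^ 2 ≤ K ^ 2 := by
    intro U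
    refine (Finset.sum_le_sum_of_subset_of_nonneg (Finset.erase_subset _ _)
      (fun _ _ _ => sq_nonneg _)).trans ((col_bound _ b).trans ?_)
    exact pow_le_pow_left₀ (norm_nonneg _) ((opNorm_conj_le U M).trans hK) 2
  calc _ ≤ ∫ U, K ^ 2 ∂μ := integral_mono (integrable_finsetSum _ (fun c _ => int_sq μ M c b))
        (integrable_const _) h2
    _ = _ := by simp

lemma rt_entry (U : Matrix.unitaryGroup (Fin N) ℂ) (a b : Fin N) :
    ‖cj M U a a - cj M U b b‖ ^ 2 ≤
      12 * ‖cj M (rtU a b * U) a b‖ ^ 2 + 3 * ‖cj M U a b‖ ^ 2 + 3 * ‖cj M U b a‖ ^ 2 := by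
  have h : cj M (rtU a b * U) a b = (1 / 2 : ℂ) * cj M U a b + Complex.I / 2 * cj M U a a
      - Complex.I / 2 * cj M U b b + 1 / 2 * cj M U b a := by
    rw [cj_mul]
    change (rt a b * cj M U * (rt a b)ᴴ) a b = _
    rw [rt_conj]
    simp only [Matrix.add_apply, Matrix.sub_apply, Matrix.smul_apply, smul_eq_mul, mul_sw, sw_mul,
      Equiv.swap_apply_left, Equiv.swap_apply_right]
  set Z := cj M (rtU a b * U) a b
  have h2 : Complex.I * (cj M U a a - cj M U b b) = 2 * Z - cj M U a b - cj M U b a := by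
    rw [h]; ring
  have h3 : ‖cj M U a a - cj M U b b‖ ≤ 2 * ‖Z‖ + ‖cj M U a b‖ + ‖cj M U b a‖ := by
    calc ‖cj M U a a - cj M U b b‖ = ‖Complex.I * (cj M U a a - cj M U b b)‖ := by simp
      _ ≤ ‖2 * Z - cj M U a b‖ + ‖cj M U b a‖ := by rw [h2]; exact norm_sub_le _ _
      _ ≤ ‖2 * Z‖ + ‖cj M U a b‖ + ‖cj M U b a‖ := by gcongr; exact norm_sub_le _ _
      _ = _ := by simp
  have h4 := pow_le_pow_left₀ (norm_nonneg _) h3 2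
  nlinarith [sq_nonneg (2 * ‖Z‖ - ‖cj M U a b‖), sq_nonneg (2 * ‖Z‖ - ‖cj M U b a‖),
    sq_nonneg (‖cj M U a b‖ - ‖cj M U b a‖)]

lemma int_diff (μ : Measure (Matrix.unitaryGroup (Fin N) ℂ)) [IsProbabilityMeasure μ]
    (M : Matrix (Fin N) (Fin N) ℂ) (a b : Fin N) :
    Integrable (fun U => ‖cj M U a a - cj M U b b‖ ^ 2) μ := by
  refine bdd_integrable μ _ (((cj_cont M a a).sub (cj_cont M b b)).norm.pow 2)
    ((opNorm M + opNorm M) ^ 2) fun U => ?_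
  rw [norm_pow, norm_norm]
  exact pow_le_pow_left₀ (norm_nonneg _) ((norm_sub_le _ _).trans
    (add_le_add (cj_bound M _ le_rfl U a a) (cj_bound M _ le_rfl U b b))) 2

include hK in
lemma diag_diff (hN : 1 < N) (a b : Fin N) :
    ∫ U, ‖cj M U a a - cj M U b b‖ ^ 2 ∂μ ≤ 18 * (K ^ 2 / ((N : ℝ) - 1)) := by
  have hN' : (0 : ℝ) < (N : ℝ) - 1 := by
    have : (1 : ℝ) < N := by exact_mod_cast hN
    linarith
  by_cases hab : a = b
  · subst hab; simp; positivity
  have i1 : Integrable (fun U => ‖cj M (rtU a b * U) a b‖ ^ 2) μ :=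
    (int_sq μ M a b).comp_mul_left (rtU a b)
  have i2 := int_sq μ M a b
  have i3 := int_sq μ M b a
  calc _ ≤ ∫ U, (12 * ‖cj M (rtU a b * U) a b‖ ^ 2 + 3 * ‖cj M U a b‖ ^ 2
        + 3 * ‖cj M U b a‖ ^ 2) ∂μ :=
        integral_mono (int_diff μ M a b)
          (((i1.const_mul 12).add (i2.const_mul 3)).add (i3.const_mul 3))
          (fun U => rt_entry M U a b)
    _ = 12 * ∫ U, ‖cj M U a b‖ ^ 2 ∂μ + 3 * ∫ U, ‖cj M U a b‖ ^ 2 ∂μ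
        + 3 * ∫ U, ‖cj M U b a‖ ^ 2 ∂μ := by
        have j12 : Integrable (fun U => 12 * ‖cj M (rtU a b * U) a b‖ ^ 2
            + 3 * ‖cj M U a b‖ ^ 2) μ := (i1.const_mul 12).add (i2.const_mul 3)
        rw [integral_add j12 (i3.const_mul 3), integral_add (i1.const_mul 12) (i2.const_mul 3), integral_const_mul, integral_const_mul,
          integral_const_mul, integral_mul_left_eq_self (fun U => ‖cj M U a b‖ ^ 2) (rtU a b)]
    _ ≤ _ := by
        have := offdiag μ M K hK a b hab
        have := offdiag μ M K hK b a (Ne.symm hab)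
        linarith

lemma cj_trace (U : Matrix.unitaryGroup (Fin N) ℂ) : ∑ b, cj M U b b = M.trace := by
  change (cj M U).trace = _
  unfold cj
  rw [Matrix.trace_mul_comm, ← mul_assoc]
  have hU' : (U : Matrix (Fin N) (Fin N) ℂ)ᴴ * (U : Matrix (Fin N) (Fin N) ℂ) = 1 :=
    Unitary.star_mul_self_of_mem U.2
  rw [hU', one_mul]

include hK in
lemma diag (hN : 1 < N) (a : Fin N) :
    ∫ U, ‖cj M U a a - M.trace / N‖ ^ 2 ∂μ ≤ 18 * (K ^ 2 / ((N : ℝ) - 1)) := by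
  have hN0 : (0 : ℝ) < N := by exact_mod_cast (by omega : 0 < N)
  have hNc : (N : ℂ) ≠ 0 := by exact_mod_cast hN0.ne'
  have pt : ∀ U, ‖cj M U a a - M.trace / N‖ ^ 2 ≤
      (N : ℝ)⁻¹ * ∑ b, ‖cj M U a a - cj M U b b‖ ^ 2 := by
    intro U
    have e : cj M U a a - M.trace / N = (N : ℂ)⁻¹ * ∑ b, (cj M U a a - cj M U b b) := by
      rw [Finset.sum_sub_distrib, cj_trace, Finset.sum_const, Finset.card_univ, Fintype.card_fin,
        nsmul_eq_mul]
      field_simp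
    rw [e, norm_mul, norm_inv, Complex.norm_natCast, mul_pow]
    have c1 : ‖∑ b, (cj M U a a - cj M U b b)‖ ^ 2 ≤
        N * ∑ b, ‖cj M U a a - cj M U b b‖ ^ 2 := by
      refine (pow_le_pow_left₀ (norm_nonneg _) (norm_sum_le _ _) 2).trans ?_
      have := sq_sum_le_card_mul_sum_sq (s := (Finset.univ : Finset (Fin N)))
        (f := fun b => ‖cj M U a a - cj M U b b‖)
      simpa using this
    calc _ ≤ ((N : ℝ)⁻¹) ^ 2 * (N * ∑ b, ‖cj M U a a - cj M U b b‖ ^ 2) := by gcongr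
      _ = _ := by field_simp
  have il : Integrable (fun U => ‖cj M U a a - M.trace / N‖ ^ 2) μ := by
    refine bdd_integrable μ _ (((cj_cont M a a).sub continuous_const).norm.pow 2)
      ((opNorm M + ‖M.trace / N‖) ^ 2) fun U => ?_
    rw [norm_pow, norm_norm]
    exact pow_le_pow_left₀ (norm_nonneg _) ((norm_sub_le _ _).trans
      (add_le_add (cj_bound M _ le_rfl U a a) le_rfl)) 2
  calc _ ≤ ∫ U, (N : ℝ)⁻¹ * ∑ b, ‖cj M U a a - cj M U b b‖ ^ 2 ∂μ :=
        integral_mono il ((integrable_finsetSum _ (fun b _ => int_diff μ M a b)).const_mul _) pt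
    _ = (N : ℝ)⁻¹ * ∑ b, ∫ U, ‖cj M U a a - cj M U b b‖ ^ 2 ∂μ := by
        rw [integral_const_mul, integral_finsetSum _ (fun b _ => int_diff μ M a b)]
    _ ≤ (N : ℝ)⁻¹ * ∑ b : Fin N, 18 * (K ^ 2 / ((N : ℝ) - 1)) := by
        gcongr with b
        exact diag_diff μ M K hK hN a b
    _ = _ := by
        rw [Finset.sum_const, Finset.card_univ, Fintype.card_fin, nsmul_eq_mul]
        field_simp

include hK in
/-- L1 concentration around the mean. -/
lemma conc (hN : 1 < N) (a b : Fin N) :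
    ∫ U, ‖cj M U a b - ∫ W, cj M W a b ∂μ‖ ∂μ ≤ 2 * √(18 * (K ^ 2 / ((N : ℝ) - 1))) := by
  have hN' : (0 : ℝ) < (N : ℝ) - 1 := by
    have : (1 : ℝ) < N := by exact_mod_cast hN
    linarith
  obtain ⟨c, hc⟩ : ∃ c : ℂ, ∫ U, ‖cj M U a b - c‖ ^ 2 ∂μ ≤ 18 * (K ^ 2 / ((N : ℝ) - 1)) := by
    by_cases hab : a = b
    · subst hab
      exact ⟨_, diag μ M K hK hN a⟩
    · refine ⟨0, ?_⟩
      simp only [sub_zero]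
      have := offdiag μ M K hK a b hab
      have : 0 ≤ K ^ 2 / ((N : ℝ) - 1) := by positivity
      linarith
  have ii : Integrable (fun U => cj M U a b) μ :=
    bdd_integrable μ _ (cj_cont M a b) _ fun U => cj_bound M _ le_rfl U a b
  have i1 : Integrable (fun U => ‖cj M U a b - c‖) μ := (ii.sub (integrable_const c)).norm
  have i2 : Integrable (fun U => ‖cj M U a b - c‖ ^ 2) μ := by
    refine bdd_integrable μ _ (((cj_cont M a b).sub continuous_const).norm.pow 2)
      ((opNorm M + ‖c‖) ^ 2) fun U => ?_
    rw [norm_pow, norm_norm]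
    exact pow_le_pow_left₀ (norm_nonneg _) ((norm_sub_le _ _).trans
      (add_le_add (cj_bound M _ le_rfl U a b) le_rfl)) 2
  set t := ∫ U, ‖cj M U a b - c‖ ∂μ with ht
  have hsq : t ^ 2 ≤ ∫ U, ‖cj M U a b - c‖ ^ 2 ∂μ := by
    have h0 : 0 ≤ ∫ U, (‖cj M U a b - c‖ - t) ^ 2 ∂μ := integral_nonneg fun U => sq_nonneg _
    have h1 : ∫ U, (‖cj M U a b - c‖ - t) ^ 2 ∂μ =
        ∫ U, ‖cj M U a b - c‖ ^ 2 ∂μ - (2 * t) * t + t ^ 2 := by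
      have : (fun U => (‖cj M U a b - c‖ - t) ^ 2) =
          fun U => (‖cj M U a b - c‖ ^ 2 - (2 * t) * ‖cj M U a b - c‖) + t ^ 2 := by
        ext U; ring
      have j12 : Integrable (fun U => ‖cj M U a b - c‖ ^ 2 - (2 * t) * ‖cj M U a b - c‖) μ :=
        i2.sub (i1.const_mul _)
      rw [this, integral_add j12 (integrable_const _),
        integral_sub i2 (i1.const_mul _), integral_const_mul, ← ht]
      simp
    nlinarith
  have htl : t ≤ √(18 * (K ^ 2 / ((N : ℝ) - 1))) := Real.le_sqrt_of_sq_le (hsq.trans hc)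
  have hm : ‖c - ∫ W, cj M W a b ∂μ‖ ≤ t := by
    have : c - ∫ W, cj M W a b ∂μ = ∫ W, (c - cj M W a b) ∂μ := by
      rw [integral_sub (integrable_const c) ii]; simp
    rw [this]
    refine (norm_integral_le_integral_norm _).trans (le_of_eq ?_)
    simp only [norm_sub_rev c]
    rfl
  calc _ ≤ ∫ U, (‖cj M U a b - c‖ + t) ∂μ := by
        refine integral_mono (ii.sub (integrable_const _)).norm (i1.add (integrable_const _)) ?_
        intro U
        exact (norm_sub_le_norm_sub_add_norm_sub _ c _).trans (add_le_add le_rfl hm)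
    _ = t + t := by rw [integral_add i1 (integrable_const _)]; simp [← ht]
    _ ≤ _ := by linarith

end main

lemma prod_diff_bound {ι : Type*} (T : Finset ι) (x c : ι → ℂ) (K : ℝ) (hK : 1 ≤ K)
    (hx : ∀ s, ‖x s‖ ≤ K) (hc : ∀ s, ‖c s‖ ≤ K) :
    ‖∏ s ∈ T, x s - ∏ s ∈ T, c s‖ ≤ K ^ T.card * ∑ s ∈ T, ‖x s - c s‖ := by
  classical
  induction T using Finset.induction_on with
  | empty => simp
  | insert a T ha ih =>
    rw [Finset.prod_insert ha, Finset.prod_insert ha, Finset.sum_insert ha,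
      Finset.card_insert_of_notMem ha]
    have e : x a * ∏ s ∈ T, x s - c a * ∏ s ∈ T, c s =
      x a * (∏ s ∈ T, x s - ∏ s ∈ T, c s) + (x a - c a) * ∏ s ∈ T, c s := by ring
    have hp : ‖∏ s ∈ T, c s‖ ≤ K ^ T.card := by
      rw [norm_prod]
      exact (Finset.prod_le_prod (fun _ _ => norm_nonneg _) (fun s _ => hc s)).trans
        (by rw [Finset.prod_const])
    have hK0 : 0 ≤ K := by linarith
    rw [e]
    calc _ ≤ ‖x a‖ * ‖∏ s ∈ T, x s - ∏ s ∈ T, c s‖ + ‖x a - c a‖ * ‖∏ s ∈ T, c s‖ := by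
          refine (norm_add_le _ _).trans ?_
          rw [norm_mul, norm_mul]
      _ ≤ K * (K ^ T.card * ∑ s ∈ T, ‖x s - c s‖) + ‖x a - c a‖ * (K ^ T.card * K) := by
          gcongr
          · exact hx a
          · exact hp.trans (le_mul_of_one_le_right (by positivity) hK)
      _ = _ := by ring

/-- For a unitarily invariant ensemble, matrix entries of polynomials in the ensemble
asymptotically factorize in expectation:
`E ∏_s [q_s(A(N))]_{j_s,i_s} − ∏_s E [q_s(A(N))]_{j_s,i_s} → 0`. -/
theorem unitarilyInvariant_entries_factorize
    (k : ℕ)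
    (Λ : (N : ℕ) → Fin k → Matrix (Fin N) (Fin N) ℂ)
    (hΛsa : ∀ N t, (Λ N t)ᴴ = Λ N t)
    (hΛbdd : ∃ C : ℝ, ∀ N t, opNorm (Λ N t) ≤ C)
    (μ : (N : ℕ) → Measure (Matrix.unitaryGroup (Fin N) ℂ))
    (hprob : ∀ N, IsProbabilityMeasure (μ N))
    (hinv : ∀ N, (μ N).IsMulLeftInvariant)
    (m : ℕ) (q : Fin (m + 1) → FreeAlgebra ℂ (Fin k)) (j i : Fin (m + 1) → ℕ) :
    Tendsto (fun N =>
        (∫ U, (∏ s : Fin (m + 1), entryPad (evalAt (Λ N) U (q s)) (j s) (i s)) ∂(μ N))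
          - ∏ s : Fin (m + 1), ∫ U, entryPad (evalAt (Λ N) U (q s)) (j s) (i s) ∂(μ N))
      atTop (nhds 0) := by
  choose K0 hK0 using fun s => opNorm_lift_bound Λ hΛbdd (q s)
  obtain ⟨K, hK1, hK⟩ : ∃ K : ℝ, 1 ≤ K ∧ ∀ s N, opNorm (FreeAlgebra.lift ℂ (Λ N) (q s)) ≤ K := by
    refine ⟨1 + ∑ s, |K0 s|, ?_, fun s N => ?_⟩
    · have : 0 ≤ ∑ s, |K0 s| := Finset.sum_nonneg fun _ _ => abs_nonneg _
      linarith
    · have h1 : |K0 s| ≤ ∑ s, |K0 s| :=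
        Finset.single_le_sum (f := fun s => |K0 s|) (fun _ _ => abs_nonneg _) (Finset.mem_univ s)
      have := hK0 s N
      have := le_abs_self (K0 s)
      linarith
  have hlim : Tendsto (fun N : ℕ =>
      K ^ (m + 1) * ∑ _s : Fin (m + 1), 2 * √(18 * (K ^ 2 / ((N : ℝ) - 1)))) atTop (nhds 0) := by
    have h1 : Tendsto (fun N : ℕ => K ^ 2 / ((N : ℝ) - 1)) atTop (nhds 0) :=
      Tendsto.div_atTop tendsto_const_nhds
        (tendsto_atTop_add_const_right _ (-1) tendsto_natCast_atTop_atTop)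
    have h2 := (Real.continuous_sqrt.tendsto _).comp (h1.const_mul 18)
    rw [mul_zero, Real.sqrt_zero] at h2
    have h3 := (tendsto_finsetSum (Finset.univ : Finset (Fin (m + 1)))
      (fun _ _ => h2.const_mul 2)).const_mul (K ^ (m + 1))
    simpa using h3
  refine squeeze_zero_norm' ?_ hlim
  filter_upwards [eventually_gt_atTop (1 + ∑ s, (j s + i s))] with N hN
  have hjs : ∀ s, j s + i s ≤ ∑ s, (j s + i s) := fun s =>
    Finset.single_le_sum (f := fun s => j s + i s) (fun _ _ => Nat.zero_le _) (Finset.mem_univ s)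
  have hj : ∀ s, j s < N := fun s => by have := hjs s; omega
  have hi : ∀ s, i s < N := fun s => by have := hjs s; omega
  have hN1 : 1 < N := by omega
  haveI := hprob N
  haveI := hinv N
  have hent : ∀ U s, entryPad (evalAt (Λ N) U (q s)) (j s) (i s) =
      cj (FreeAlgebra.lift ℂ (Λ N) (q s)) U ⟨j s, hj s⟩ ⟨i s, hi s⟩ := by
    intro U s
    rw [evalAt_conj]
    simp [entryPad, hj s, hi s, cj]
  simp only [hent]
  set X : Fin (m + 1) → Matrix.unitaryGroup (Fin N) ℂ → ℂ := fun s U =>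
    cj (FreeAlgebra.lift ℂ (Λ N) (q s)) U ⟨j s, hj s⟩ ⟨i s, hi s⟩ with hX
  change ‖∫ U, ∏ s, X s U ∂(μ N) - ∏ s, ∫ U, X s U ∂(μ N)‖ ≤ _
  have hXc : ∀ s, Continuous (X s) := fun s => cj_cont _ _ _
  have hXb : ∀ s U, ‖X s U‖ ≤ K := fun s U => cj_bound _ _ (hK s N) U _ _
  have hEb : ∀ s, ‖∫ U, X s U ∂(μ N)‖ ≤ K := fun s => by
    have := norm_integral_le_of_norm_le_const (μ := μ N) (Eventually.of_forall (hXb s))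
    simpa using this
  have iX : ∀ s, Integrable (X s) (μ N) := fun s => bdd_integrable _ _ (hXc s) K (hXb s)
  have iP : Integrable (fun U => ∏ s, X s U) (μ N) := by
    refine bdd_integrable _ _ (continuous_finsetProd _ fun s _ => hXc s)
      (K ^ (Finset.univ : Finset (Fin (m + 1))).card) fun U => ?_
    rw [norm_prod]
    exact (Finset.prod_le_prod (fun _ _ => norm_nonneg _) (fun s _ => hXb s U)).trans
      (by rw [Finset.prod_const])
  have iD : ∀ s, Integrable (fun U => ‖X s U - ∫ W, X s W ∂(μ N)‖) (μ N) := fun s =>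
    ((iX s).sub (integrable_const _)).norm
  have e : ∫ U, ∏ s, X s U ∂(μ N) - ∏ s, ∫ U, X s U ∂(μ N) =
      ∫ U, (∏ s, X s U - ∏ s, ∫ W, X s W ∂(μ N)) ∂(μ N) := by
    rw [integral_sub iP (integrable_const _)]; simp
  rw [e]
  calc _ ≤ ∫ U, ‖∏ s, X s U - ∏ s, ∫ W, X s W ∂(μ N)‖ ∂(μ N) := norm_integral_le_integral_norm _
    _ ≤ ∫ U, K ^ (m + 1) * ∑ s, ‖X s U - ∫ W, X s W ∂(μ N)‖ ∂(μ N) := by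
        refine integral_mono (iP.sub (integrable_const _)).norm
          ((integrable_finsetSum _ fun s _ => iD s).const_mul _) fun U => ?_
        have := prod_diff_bound Finset.univ (fun s => X s U) (fun s => ∫ W, X s W ∂(μ N)) K hK1
          (fun s => hXb s U) hEb
        simpa using this
    _ = K ^ (m + 1) * ∑ s, ∫ U, ‖X s U - ∫ W, X s W ∂(μ N)‖ ∂(μ N) := by
        rw [integral_const_mul, integral_finsetSum _ fun s _ => iD s]
    _ ≤ _ := by
        have hK00 : 0 ≤ K := by linarith
        gcongr with s
        exact conc (μ N) _ K (hK s N) hN1 _ _
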